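/- Let Q be a finitely presented group. Then the following are equivalent: (i) for every finitely generated group G, normal subgroup N of G with quotient map p : G → G/N and G/N isomorphic to Q, the inclusion of the fibre product P = {(g,g') ∈ G × G : p(g) = p(g')} into G × G induces an isomorphism of profinite completions (i.e. every homomorphism from G × G onto a finite group remains surjective when restricted to P, and for every finite-index normal subgroup M of P there exists a finite-index normal subgroup L of G × G with L ∩ P ≤ M); (ii) Q has no proper subgroups of finite index and H₂(Q;ℤ) = 0. -/

import Mathlib

/-- A group `Q` has no nontrivial finite quotients: every homomorphism from `Q`
to a finite group is trivial. -/
def NoNontrivialFiniteQuotients (Q : Type*) [Group Q] : Prop :=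
  ∀ (H : Type) [Group H] [Finite H] (f : Q →* H) (q : Q), f q = 1

/-- The map of profinite completions induced by the inclusion of the subgroup `P` of `Γ`
is surjective: every homomorphism from `Γ` onto a finite group remains surjective when
restricted to `P`. -/
def ProfiniteSurj {Γ : Type*} [Group Γ] (P : Subgroup Γ) : Prop :=
  ∀ (H : Type) [Group H] [Finite H] (f : Γ →* H),
    Function.Surjective f → Function.Surjective (f.comp P.subtype)

/-- The map of profinite completions induced by the inclusion of the subgroup `P` of `Γ`
is injective: for every finite-index normal subgroup `M` of `P` there is a finite-index
normal subgroup `L` of `Γ` with `L ∩ P ≤ M`. -/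
def ProfiniteInj {Γ : Type*} [Group Γ] (P : Subgroup Γ) : Prop :=
  ∀ M : Subgroup ↥P, M.Normal → M.FiniteIndex →
    ∃ L : Subgroup Γ, L.Normal ∧ L.FiniteIndex ∧ L.subgroupOf P ≤ M

/-- The second group homology `H₂(Q;ℤ)` with trivial ℤ-coefficients, realized via Hopf's
formula `H₂(Q;ℤ) ≅ (R ∩ [F,F])/[F,R]` for the free presentation `1 → R → F → Q → 1`
with `F` the free group on the underlying set of `Q`. -/
def H2 (Q : Type*) [Group Q] : Type _ :=
  ↥((FreeGroup.lift (id : Q → Q)).ker ⊓ commutator (FreeGroup Q)) ⧸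
    ((⁅(⊤ : Subgroup (FreeGroup Q)), (FreeGroup.lift (id : Q → Q)).ker⁆).subgroupOf
      ((FreeGroup.lift (id : Q → Q)).ker ⊓ commutator (FreeGroup Q)))

/-- A group is finitely presented if it admits a presentation with finitely many
generators and finitely many relators. -/
def FinitelyPresentedGroup (Q : Type*) [Group Q] : Prop :=
  ∃ (k : ℕ) (R : Finset (FreeGroup (Fin k))),
    Nonempty (PresentedGroup (↑R : Set (FreeGroup (Fin k))) ≃* Q)

/-- A group `G` is residually finite if every nontrivial element is detected by a
homomorphism to a finite group. -/
def ResiduallyFinite (G : Type*) [Group G] : Prop :=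
  ∀ g : G, g ≠ 1 → ∃ (H : Type) (_ : Group H) (_ : Finite H) (f : G →* H), f g ≠ 1

/-- The fibre product `P = {(g,g') : p g = p g'}` of a homomorphism `p : G →* Q`,
as a subgroup of `G × G`. -/
def fiberProduct {G Q : Type*} [Group G] [Group Q] (p : G →* Q) : Subgroup (G × G) where
  carrier := {x | p x.1 = p x.2}
  one_mem' := rfl
  mul_mem' := by
    intro a b ha hb
    simp only [Set.mem_setOf_eq, Prod.fst_mul, Prod.snd_mul, map_mul] at *
    rw [ha, hb]
  inv_mem' := by
    intro a ha
    simp only [Set.mem_setOf_eq, Prod.fst_inv, Prod.snd_inv, map_inv] at *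
    rw [ha]

section

open Subgroup
open scoped commutatorElement

theorem Subgroup.FiniteIndex.comap {G H : Type*} [Group G] [Group H] {K : Subgroup H}
    (hK : K.FiniteIndex) (f : G →* H) : (K.comap f).FiniteIndex :=
  ⟨by rw [index_comap]; exact isFiniteRelIndex_of_finiteIndex.relIndex_ne_zero⟩

/-- A subgroup that together with the centre fills the group contains the derived subgroup,
as the derived subgroup of the subgroup. -/
theorem commutator_le_commutator_of_forall_mul_center {E : Type*} [Group E] (H : Subgroup E)
    (hH : ∀ x : E, ∃ h ∈ H, ∃ z ∈ center E, x = z * h) : commutator E ≤ ⁅H, H⁆ := by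
  rw [commutator_def, commutator_le]
  intro x _ y _
  obtain ⟨h, hh, z, hz, rfl⟩ := hH x
  obtain ⟨k, hk, w, hw, rfl⟩ := hH y
  rw [mem_center_iff] at hz hw
  have hswap (x y : E) : ⁅x, y⁆ = x * y * (y * x)⁻¹ := by simp [commutatorElement_def, mul_assoc]
  have h1 : z * h * (w * k) = h * k * (z * w) := by
    rw [← hw, ← hz h, mul_assoc, ← mul_assoc z, ← hz k, ← mul_assoc, ← mul_assoc, mul_assoc]
  have h2 : w * k * (z * h) = k * h * (z * w) := by
    rw [← hz, ← hw k, mul_assoc, ← mul_assoc w, ← hw h, ← mul_assoc, ← mul_assoc, mul_assoc,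
      hz w]
  have key : ⁅z * h, w * k⁆ = ⁅h, k⁆ := by
    rw [hswap, h1, h2, hswap, mul_inv_rev, ← mul_assoc, mul_inv_cancel_right]
  rw [key]
  exact commutator_mem_commutator hh hk

theorem Group.IsPerfect.eq_top_of_forall_mul_center {E : Type*} [Group E] [Group.IsPerfect E]
    (H : Subgroup E) (hH : ∀ x : E, ∃ h ∈ H, ∃ z ∈ center E, x = z * h) : H = ⊤ := by
  rw [eq_top_iff, ← Group.IsPerfect.commutator_eq_top (G := E)]
  exact (commutator_le_commutator_of_forall_mul_center H hH).trans (commutator_le_self H)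

/-- A finitely generated abelian group without proper subgroups of finite index is trivial. -/
theorem CommGroup.subsingleton_of_forall_finiteIndex_eq_top {A : Type*} [CommGroup A]
    [Group.FG A] (hA : ∀ K : Subgroup A, K.FiniteIndex → K = ⊤) : Subsingleton A := by
  suffices h : Finite A by
    have := hA ⊥ inferInstance
    exact Subgroup.subsingleton_iff.mp (subsingleton_of_bot_eq_top this)
  have hsq : (powMonoidHom 2 : A →* A).range = ⊤ := by
    apply hA
    rw [finiteIndex_iff_finite_quotient]
    apply CommGroup.finite_of_fg_isMulTorsion
    intro g
    induction g using QuotientGroup.induction_on with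
    | H a =>
      refine isOfFinOrder_iff_pow_eq_one.mpr ⟨2, two_pos, ?_⟩
      rw [← QuotientGroup.mk_pow, QuotientGroup.eq_one_iff]
      exact ⟨a, rfl⟩
  have : Module.Finite ℤ (Additive A) := Module.Finite.iff_addGroup_fg.mpr inferInstance
  obtain ⟨r, hr, hra⟩ := Submodule.exists_sub_one_mem_and_smul_eq_zero_of_fg_of_le_smul
    (Ideal.span {(2 : ℤ)}) (⊤ : Submodule ℤ (Additive A)) Module.Finite.fg_top (by
      intro a _
      obtain ⟨b, hb⟩ := hsq.ge (mem_top a.toMul)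
      have : a = (2 : ℤ) • Additive.ofMul b := by
        rw [two_smul, ← ofMul_mul, ← pow_two]
        exact congrArg Additive.ofMul hb.symm
      rw [this]
      exact Submodule.smul_mem_smul (Ideal.mem_span_singleton_self 2) trivial)
  rw [Ideal.mem_span_singleton] at hr
  apply CommGroup.finite_of_fg_isMulTorsion
  intro a
  refine isOfFinOrder_iff_zpow_eq_one.mpr ⟨r, by rintro rfl; omega, ?_⟩
  exact hra (Additive.ofMul a) trivial

/-- A finitely generated group without proper subgroups of finite index is perfect. -/
theorem Group.isPerfect_of_forall_finiteIndex_eq_top {Q : Type*} [Group Q] [Group.FG Q]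
    (hQ : ∀ K : Subgroup Q, K.FiniteIndex → K = ⊤) : Group.IsPerfect Q := by
  have : Group.FG (Abelianization Q) := QuotientGroup.fg _
  have : Subsingleton (Abelianization Q) := by
    apply CommGroup.subsingleton_of_forall_finiteIndex_eq_top
    intro K hK
    have := hQ (K.comap Abelianization.of) (hK.comap _)
    rw [eq_top_iff]
    rintro ⟨x⟩ _
    exact this.ge (mem_top x)
  refine Group.isPerfect_def.mpr (eq_top_iff.mpr fun x _ => ?_)
  rw [← Abelianization.ker_of, MonoidHom.mem_ker]
  exact Subsingleton.elim _ _

/-- A perfect central extension of a finitely presented group is finitely generated, and so is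
the kernel of the projection. -/
theorem Group.IsPerfect.fg_and_fg_ker {E Q : Type*} [Group E] [Group Q] [Group.IsPerfect E]
    [Group.IsFinitelyPresented Q] (π : E →* Q) (hπ : Function.Surjective π)
    (hker : π.ker ≤ center E) : Group.FG E ∧ Group.FG π.ker := by
  obtain ⟨n, φ, hφ, hφker⟩ := Group.IsFinitelyPresented.out (G := Q)
  let ψ : FreeGroup (Fin n) →* E :=
    FreeGroup.lift fun i => Function.surjInv hπ (φ (FreeGroup.of i))
  have hψ : π.comp ψ = φ := by
    ext i
    simp [ψ, Function.surjInv_eq hπ]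
  have hψ' (w) : π (ψ w) = φ w := DFunLike.congr_fun hψ w
  have hsurj : Function.Surjective ψ := by
    rw [← MonoidHom.range_eq_top]
    apply Group.IsPerfect.eq_top_of_forall_mul_center
    intro x
    obtain ⟨w, hw⟩ := hφ (π x)
    refine ⟨ψ w, ⟨w, rfl⟩, x * (ψ w)⁻¹, hker ?_, by group⟩
    rw [MonoidHom.mem_ker, map_mul, map_inv, hψ', hw, mul_inv_cancel]
  refine ⟨Group.fg_of_surjective hsurj, ?_⟩
  have hmap : φ.ker.map ψ = π.ker := by
    rw [← hψ, ← MonoidHom.comap_ker, map_comap_eq_self_of_surjective hsurj]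
  obtain ⟨S, hS, hSker⟩ := hmap ▸ hφker.map hsurj
  have hSc : S ⊆ center E := (subset_normalClosure.trans hSker.le).trans hker
  have hn : (closure S).Normal := by
    refine ⟨fun x hx g => ?_⟩
    have : x ∈ center E := (closure_le _).mpr hSc hx
    rwa [mem_center_iff.mp this g, mul_inv_cancel_right]
  rw [Group.fg_iff_subgroup_fg, ← hSker]
  refine (Subgroup.fg_iff _).mpr ⟨S, le_antisymm closure_le_normalClosure ?_, hS⟩
  exact normalClosure_le_normal subset_closure

/-- Perfect central extensions inherit the absence of proper subgroups of finite index. -/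
theorem Group.IsPerfect.eq_top_of_finiteIndex_of_central {E Q : Type*} [Group E] [Group Q]
    [Group.IsPerfect E] (hQ : ∀ K : Subgroup Q, K.FiniteIndex → K = ⊤) (π : E →* Q)
    (hπ : Function.Surjective π) (hker : π.ker ≤ center E) (K : Subgroup E)
    (hK : K.FiniteIndex) : K = ⊤ := by
  have hmap : K.map π = ⊤ :=
    hQ _ ⟨ne_zero_of_dvd_ne_zero hK.index_ne_zero (K.index_map_dvd hπ)⟩
  apply Group.IsPerfect.eq_top_of_forall_mul_center
  intro x
  obtain ⟨k, hk, hkx⟩ := hmap.ge (mem_top (π x))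
  refine ⟨k, hk, x * k⁻¹, hker ?_, by group⟩
  rw [MonoidHom.mem_ker, map_mul, map_inv, hkx, mul_inv_cancel]

theorem Subgroup.prod_eq_top_of_finiteIndex {G H : Type*} [Group G] [Group H]
    (hG : ∀ K : Subgroup G, K.FiniteIndex → K = ⊤) (hH : ∀ K : Subgroup H, K.FiniteIndex → K = ⊤)
    (L : Subgroup (G × H)) (hL : L.FiniteIndex) : L = ⊤ := by
  have h1 := hG (L.comap (MonoidHom.inl G H)) (hL.comap _)
  have h2 := hH (L.comap (MonoidHom.inr G H)) (hL.comap _)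
  rw [eq_top_iff]
  rintro ⟨g, h⟩ _
  have := L.mul_mem (h1.ge (mem_top g)) (h2.ge (mem_top h))
  simpa using this

/-- The homomorphism `(g, g') ↦ g * g'⁻¹` from the fibre product of a central extension with
itself to the kernel. -/
def fiberProduct.divHom {G Q : Type*} [Group G] [Group Q] (p : G →* Q)
    (hker : p.ker ≤ center G) : fiberProduct p →* p.ker where
  toFun x := ⟨x.1.1 * x.1.2⁻¹, by
    have hx : p x.1.1 = p x.1.2 := x.2
    rw [MonoidHom.mem_ker, map_mul, map_inv, hx, mul_inv_cancel]⟩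
  map_one' := by ext; simp
  map_mul' x y := by
    have hy : p y.1.1 = p y.1.2 := y.2
    have hc : y.1.1 * y.1.2⁻¹ ∈ center G := hker (by
      rw [MonoidHom.mem_ker, map_mul, map_inv, hy, mul_inv_cancel])
    ext
    have := mem_center_iff.mp hc x.1.1
    simp only [coe_mul, Prod.fst_mul, Prod.snd_mul, mul_inv_rev]
    rw [mul_assoc x.1.1 y.1.1, ← mul_assoc y.1.1, ← mul_assoc, this]
    rw [mul_assoc, ← mem_center_iff.mp hc]

/-- If the fibre product of a central extension without proper subgroups of finite index is
profinitely injective, then the kernel has no proper subgroups of finite index. -/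
theorem ProfiniteInj.ker_eq_top_of_finiteIndex {G Q : Type*} [Group G] [Group Q] (p : G →* Q)
    (hker : p.ker ≤ center G) (hG : ∀ K : Subgroup G, K.FiniteIndex → K = ⊤)
    (hinj : ProfiniteInj (fiberProduct p)) (B : Subgroup p.ker) (hB : B.FiniteIndex) :
    B = ⊤ := by
  have hBn : B.Normal := ⟨fun b hb g => by
    have : g * b = b * g := Subtype.ext (mem_center_iff.mp (hker b.2) g)
    rwa [this, mul_inv_cancel_right]⟩
  obtain ⟨L, -, hL, hLM⟩ := hinj (B.comap (fiberProduct.divHom p hker)) inferInstance (hB.comap _)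
  rw [prod_eq_top_of_finiteIndex hG hG L hL] at hLM
  rw [eq_top_iff]
  intro n _
  have hn : ((n : G), (1 : G)) ∈ fiberProduct p := by
    change p n = p 1
    rw [map_one]
    exact n.2
  have := hLM (x := ⟨_, hn⟩) (by simp)
  have hd : fiberProduct.divHom p hker ⟨_, hn⟩ = n := Subtype.ext (by simp [fiberProduct.divHom])
  rwa [mem_comap, hd] at this

theorem subsingleton_H2_iff (Q : Type*) [Group Q] :
    Subsingleton (H2 Q) ↔ (FreeGroup.lift (id : Q → Q)).ker ⊓ commutator (FreeGroup Q) ≤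
      ⁅(⊤ : Subgroup (FreeGroup Q)), (FreeGroup.lift (id : Q → Q)).ker⁆ := by
  rw [← subgroupOf_eq_top, H2, QuotientGroup.subsingleton_iff]


/-- The derived subgroup of a central extension of a perfect group is perfect and maps onto it. -/
theorem isPerfect_commutator_of_central {E Q : Type*} [Group E] [Group Q] [Group.IsPerfect Q]
    (π : E →* Q) (hπ : Function.Surjective π) (hker : π.ker ≤ center E) :
    Group.IsPerfect (commutator E) ∧ Function.Surjective (π.comp (commutator E).subtype) := by
  have hmap : (commutator E).map π = ⊤ := by
    rw [commutator_def, map_commutator, map_top_of_surjective _ hπ, ← commutator_def,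
      Group.IsPerfect.commutator_eq_top]
  refine ⟨Subgroup.isPerfect_iff.mpr (le_antisymm (commutator_le_self _) ?_), ?_⟩
  · apply commutator_le_commutator_of_forall_mul_center
    intro x
    obtain ⟨h, hh, hx⟩ := hmap.ge (mem_top (π x))
    refine ⟨h, hh, x * h⁻¹, hker ?_, by group⟩
    rw [MonoidHom.mem_ker, map_mul, map_inv, hx, mul_inv_cancel]
  · intro q
    obtain ⟨h, hh, hx⟩ := hmap.ge (mem_top q)
    exact ⟨⟨h, hh⟩, hx⟩

/-- `H₂(Q;ℤ)` vanishes as soon as every perfect central extension of the perfect group `Q` is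
trivial. -/
theorem subsingleton_H2_of_forall_perfect_central {Q : Type} [Group Q] [Group.IsPerfect Q]
    (h : ∀ (E : Type) (_ : Group E) (_ : Group.IsPerfect E) (π : E →* Q),
      Function.Surjective π → π.ker ≤ center E → π.ker = ⊥) : Subsingleton (H2 Q) := by
  rw [subsingleton_H2_iff]
  set ε := FreeGroup.lift (id : Q → Q)
  have hle : ⁅(⊤ : Subgroup (FreeGroup Q)), ε.ker⁆ ≤ ε.ker := commutator_le_right _ _
  let π : FreeGroup Q ⧸ ⁅(⊤ : Subgroup (FreeGroup Q)), ε.ker⁆ →* Q :=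
    QuotientGroup.lift _ ε hle
  have hπ : Function.Surjective π := fun q => ⟨FreeGroup.of q, by simp [π, ε]⟩
  have hker : π.ker ≤ center _ := by
    intro x hx
    rw [mem_center_iff]
    intro y
    induction x using QuotientGroup.induction_on with | H x => ?_
    induction y using QuotientGroup.induction_on with | H y => ?_
    have hx : x ∈ ε.ker := hx
    refine QuotientGroup.eq.mpr ?_
    have := commutator_mem_commutator (mem_top y⁻¹) (inv_mem hx)
    rw [← inv_mem_iff]
    simpa [commutatorElement_def, mul_assoc] using this
  obtain ⟨hperf, hsurj⟩ := isPerfect_commutator_of_central π hπ hker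
  have hbot := h _ _ hperf _ hsurj (by
    intro x hx
    rw [mem_center_iff]
    exact fun y => Subtype.ext (mem_center_iff.mp (hker (x := x) hx) y))
  rintro x ⟨hx, hxc⟩
  have hmem : (x : FreeGroup Q ⧸ ⁅(⊤ : Subgroup (FreeGroup Q)), ε.ker⁆) ∈ commutator _ := by
    have := mem_map_of_mem (QuotientGroup.mk' ⁅(⊤ : Subgroup (FreeGroup Q)), ε.ker⁆) hxc
    rw [_root_.commutator_def, map_commutator] at this
    exact commutator_mono le_top le_top this
  have hxb : (⟨_, hmem⟩ : commutator (FreeGroup Q ⧸ ⁅(⊤ : Subgroup (FreeGroup Q)), ε.ker⁆)) ∈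
      (π.comp (Subgroup.subtype _)).ker := hx
  rw [hbot, mem_bot] at hxb
  exact (QuotientGroup.eq_one_iff x).mp (congrArg Subtype.val hxb)

/-- An extension with finite kernel of a group `Q` without proper subgroups of finite index and
with `H₂(Q;ℤ) = 0` contains a finite-index normal complement to the kernel. -/
theorem exists_normal_finiteIndex_inf_ker_eq_bot {E Q : Type*} [Group E] [Group Q]
    [Group.IsPerfect Q] (hQ : ∀ K : Subgroup Q, K.FiniteIndex → K = ⊤)
    (hH : Subsingleton (H2 Q)) (π : E →* Q) (hπ : Function.Surjective π) [Finite π.ker] :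
    ∃ T : Subgroup E, T.Normal ∧ T.FiniteIndex ∧ T ⊓ π.ker = ⊥ := by
  rw [subsingleton_H2_iff] at hH
  let C : Subgroup E := centralizer (π.ker : Set E)
  have hC : C.FiniteIndex := by
    refine finiteIndex_of_le (H := (MulAut.conjNormal (H := π.ker)).ker) fun g hg => ?_
    rw [mem_centralizer_iff]
    intro n hn
    have := congrArg Subtype.val (DFunLike.congr_fun (MonoidHom.mem_ker.mp hg) ⟨n, hn⟩)
    rw [MulAut.conjNormal_apply] at this
    exact (mul_inv_eq_iff_eq_mul.mp this).symm
  have hCmap : C.map π = ⊤ :=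
    hQ _ ⟨ne_zero_of_dvd_ne_zero hC.index_ne_zero (C.index_map_dvd hπ)⟩
  choose c hcC hc using fun q => hCmap.ge (mem_top q)
  set ε := FreeGroup.lift (id : Q → Q)
  let φ : FreeGroup Q →* E := FreeGroup.lift c
  have hφC : φ.range ≤ C := FreeGroup.range_lift_le (by rintro _ ⟨q, rfl⟩; exact hcC q)
  have hφ : π.comp φ = ε := by
    ext q
    simp [φ, ε, hc]
  have hφ' (w) : π (φ w) = ε w := DFunLike.congr_fun hφ w
  have hcomm (w : FreeGroup Q) {n : E} (hn : n ∈ π.ker) : n * φ w = φ w * n :=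
    mem_centralizer_iff.mp (hφC ⟨w, rfl⟩) n hn
  have hεmap : (commutator (FreeGroup Q)).map ε = ⊤ := by
    rw [commutator_def, map_commutator,
      map_top_of_surjective _ fun q => ⟨FreeGroup.of q, by simp [ε]⟩, ← commutator_def,
      Group.IsPerfect.commutator_eq_top]
  have hdecomp (x : E) : ∃ w ∈ commutator (FreeGroup Q), ∃ n ∈ π.ker, x = n * φ w := by
    obtain ⟨w, hw, hx⟩ := hεmap.ge (mem_top (π x))
    refine ⟨w, hw, x * (φ w)⁻¹, ?_, by group⟩
    rw [MonoidHom.mem_ker, map_mul, map_inv, hφ', hx, mul_inv_cancel]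
  refine ⟨(commutator (FreeGroup Q)).map φ, ⟨?_⟩, ?_, ?_⟩
  · rintro _ ⟨v, hv, rfl⟩ x
    obtain ⟨w, hw, n, hn, rfl⟩ := hdecomp x
    refine ⟨w * v * w⁻¹, (inferInstance : (commutator (FreeGroup Q)).Normal).conj_mem v hv w, ?_⟩
    have := hcomm (w * v * w⁻¹) hn
    simp only [map_mul, map_inv] at this ⊢
    rw [mul_inv_rev, ← mul_assoc, eq_mul_inv_iff_mul_eq, ← this]
    simp only [mul_assoc]
  · rw [finiteIndex_iff_finite_quotient]
    refine Finite.of_surjective (fun n : π.ker => (QuotientGroup.mk (n : E) : E ⧸ _)) ?_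
    rintro ⟨x⟩
    obtain ⟨w, hw, n, hn, rfl⟩ := hdecomp x
    exact ⟨⟨n, hn⟩, QuotientGroup.eq.mpr ⟨w, hw, by simp⟩⟩
  · rw [eq_bot_iff]
    rintro _ ⟨⟨w, hw, rfl⟩, hker⟩
    have hwR : w ∈ ε.ker := by
      rw [MonoidHom.mem_ker, ← hφ']
      exact hker
    have hcommw : ⁅(⊤ : Subgroup (FreeGroup Q)), ε.ker⁆ ≤ φ.ker := by
      rw [commutator_le]
      intro v _ r hr
      rw [MonoidHom.mem_ker, map_commutatorElement, commutatorElement_eq_one_iff_mul_comm]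
      exact (hcomm v (by rwa [MonoidHom.mem_ker, hφ'])).symm
    exact hcommw (hH ⟨hwR, hw⟩)

theorem profiniteSurj_fiberProduct {G Q : Type*} [Group G] [Group Q]
    (hQ : ∀ K : Subgroup Q, K.FiniteIndex → K = ⊤) (p : G →* Q) (hp : Function.Surjective p) :
    ProfiniteSurj (fiberProduct p) := by
  intro H _ _ f hf y
  obtain ⟨⟨g, g'⟩, rfl⟩ := hf y
  have hk (e : G →* H) (g : G) : ∃ n ∈ p.ker, e n = e g := by
    have hmap : e.ker.map p = ⊤ :=
      hQ _ ⟨ne_zero_of_dvd_ne_zero FiniteIndex.index_ne_zero (e.ker.index_map_dvd hp)⟩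
    obtain ⟨k, hk, hkg⟩ := hmap.ge (mem_top (p g))
    refine ⟨k⁻¹ * g, ?_, ?_⟩
    · rw [MonoidHom.mem_ker, map_mul, map_inv, hkg, inv_mul_cancel]
    · rw [map_mul, map_inv, MonoidHom.mem_ker.mp hk, inv_one, one_mul]
  obtain ⟨n, hn, hng⟩ := hk (f.comp (MonoidHom.inl G G)) g
  obtain ⟨n', hn', hng'⟩ := hk (f.comp (MonoidHom.inr G G)) g'
  refine ⟨⟨(n, n'), (MonoidHom.mem_ker.mp hn).trans (MonoidHom.mem_ker.mp hn').symm⟩, ?_⟩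
  have hsplit (a b : G) : ((a, b) : G × G) = MonoidHom.inl G G a * MonoidHom.inr G G b := by simp
  change f (n, n') = f (g, g')
  rw [hsplit, hsplit g, map_mul, map_mul]
  exact congrArg₂ _ hng hng'

theorem profiniteInj_fiberProduct {G Q : Type*} [Group G] [Group Q] [Group.IsPerfect Q]
    (hQ : ∀ K : Subgroup Q, K.FiniteIndex → K = ⊤) (hH : Subsingleton (H2 Q)) (p : G →* Q)
    (hp : Function.Surjective p) : ProfiniteInj (fiberProduct p) := by
  intro M hMn hM
  let diag : G →* fiberProduct p :=
    ((MonoidHom.id G).prod (MonoidHom.id G)).codRestrict _ fun _ => rfl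
  let incl : p.ker →* fiberProduct p :=
    ((MonoidHom.inl G G).comp p.ker.subtype).codRestrict _ fun n =>
      (MonoidHom.mem_ker.mp n.2).trans (map_one p).symm
  have := hM.comap incl
  let K : Subgroup G := (M.comap incl).map p.ker.subtype
  have hKle : K ≤ p.ker := map_subtype_le _
  have hKn : K.Normal := by
    refine ⟨?_⟩
    rintro _ ⟨n, hn, rfl⟩ g
    refine ⟨⟨g * n * g⁻¹, p.normal_ker.conj_mem _ n.2 g⟩, ?_, rfl⟩
    have := hMn.conj_mem _ hn (diag g)
    rw [SetLike.mem_coe, mem_comap]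
    convert this using 1
    apply Subtype.ext
    change ((g * n * g⁻¹, 1) : G × G) = (g, g) * ((n : G), 1) * (g, g)⁻¹
    simp
  let π : G ⧸ K →* Q := QuotientGroup.lift K p hKle
  have hπ : Function.Surjective π := fun q => by
    obtain ⟨g, rfl⟩ := hp q
    exact ⟨g, rfl⟩
  have : Finite π.ker := by
    have : (M.comap incl).Normal := hMn.comap incl
    refine Finite.of_surjective (α := p.ker ⧸ M.comap incl)
      (QuotientGroup.lift _ (((QuotientGroup.mk' K).comp p.ker.subtype).codRestrict π.ker
        fun n => n.2) fun n hn => ?_) ?_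
    · exact Subtype.ext ((QuotientGroup.eq_one_iff _).mpr ⟨n, hn, rfl⟩)
    · rintro ⟨x, hx⟩
      induction x using QuotientGroup.induction_on with | H g => ?_
      exact ⟨QuotientGroup.mk (⟨g, hx⟩ : p.ker), rfl⟩
  obtain ⟨T, hTn, hT, hTker⟩ := exists_normal_finiteIndex_inf_ker_eq_bot hQ hH π hπ
  let L : Subgroup G := T.comap (QuotientGroup.mk' K) ⊓ M.comap diag
  have hL : L.FiniteIndex := by
    have := hT.comap (QuotientGroup.mk' K)
    have := hM.comap diag
    infer_instance
  refine ⟨L.prod L, inferInstance, inferInstance, ?_⟩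
  rintro ⟨⟨g, g'⟩, hgp⟩ ⟨hg, hg'⟩
  have hgp' : p g = p g' := hgp
  have hker : g * g'⁻¹ ∈ p.ker := by
    rw [MonoidHom.mem_ker, map_mul, map_inv, hgp', mul_inv_cancel]
  have hmem : QuotientGroup.mk' K (g * g'⁻¹) ∈ T ⊓ π.ker :=
    ⟨(L.mul_mem hg (L.inv_mem hg')).1, hker⟩
  rw [hTker, mem_bot, QuotientGroup.mk'_apply, QuotientGroup.eq_one_iff] at hmem
  obtain ⟨n, hn, hng⟩ := hmem
  have := M.mul_mem hn hg'.2
  convert this using 1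
  apply Subtype.ext
  change ((g, g') : G × G) = (p.ker.subtype n, 1) * (g', g')
  simp [hng]

theorem FinitelyPresentedGroup.isFinitelyPresented {Q : Type*} [Group Q]
    (hQ : FinitelyPresentedGroup Q) : Group.IsFinitelyPresented Q := by
  obtain ⟨k, R, ⟨e⟩⟩ := hQ
  exact Group.IsFinitelyPresented.equiv e

theorem Group.IsFinitelyPresented.fg {Q : Type*} [Group Q] [Group.IsFinitelyPresented Q] :
    Group.FG Q := by
  obtain ⟨n, φ, hφ, -⟩ := Group.IsFinitelyPresented.out (G := Q)
  exact Group.fg_of_surjective hφ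

/-- If the diagonal of `Q × Q` is profinitely dense then `Q` has no proper subgroups of finite
index. -/
theorem ProfiniteSurj.eq_top_of_finiteIndex {Q : Type} [Group Q]
    (h : ProfiniteSurj (fiberProduct (MonoidHom.id Q))) (K : Subgroup Q) (hK : K.FiniteIndex) :
    K = ⊤ := by
  rw [eq_top_iff]
  refine le_trans ?_ K.normalCore_le
  let f := QuotientGroup.mk' K.normalCore
  intro x _
  obtain ⟨⟨⟨a, b⟩, hab⟩, hx⟩ := h _ (f.prodMap f)
    (Prod.map_surjective.mpr ⟨QuotientGroup.mk'_surjective _, QuotientGroup.mk'_surjective _⟩)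
    (f x, 1)
  obtain rfl : a = b := hab
  obtain ⟨h1, h2⟩ := Prod.ext_iff.mp hx
  exact (QuotientGroup.eq_one_iff x).mp (h1.symm.trans h2)

end

/-- **Theorem 1.2.** Let `Q` be a finitely presented group. The inclusion of the fibre
product `P ↪ G × G` induces an isomorphism of profinite completions for every short exact
sequence `1 → N → G → Q → 1` with `G` finitely generated (equivalently, every surjection
`p : G → Q`) if and only if `Q` has no proper subgroups of finite index and
`H₂(Q;ℤ) = 0`. -/
theorem fiberProduct_profinite_iso_iff_no_finite_index_and_H2_trivial
    (Q : Type) [Group Q] (hQ : FinitelyPresentedGroup Q) :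
    (∀ (G : Type) (_ : Group G) (_ : Group.FG G) (p : G →* Q), Function.Surjective p →
        ProfiniteSurj (fiberProduct p) ∧ ProfiniteInj (fiberProduct p)) ↔
      ((∀ K : Subgroup Q, K.FiniteIndex → K = ⊤) ∧ Subsingleton (H2 Q)) := by
  have := hQ.isFinitelyPresented
  have hfg : Group.FG Q := Group.IsFinitelyPresented.fg
  constructor
  · intro h
    have hfin : ∀ K : Subgroup Q, K.FiniteIndex → K = ⊤ :=
      (h Q _ hfg (MonoidHom.id Q) Function.surjective_id).1.eq_top_of_finiteIndex
    have hperf := Group.isPerfect_of_forall_finiteIndex_eq_top hfin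
    refine ⟨hfin, subsingleton_H2_of_forall_perfect_central fun E _ _ π hπ hker => ?_⟩
    obtain ⟨hE, hkerfg⟩ := Group.IsPerfect.fg_and_fg_ker π hπ hker
    let _ : CommGroup π.ker :=
      { mul_comm := fun a b => Subtype.ext (Subgroup.mem_center_iff.mp (hker b.2) a) }
    have : Subsingleton π.ker := CommGroup.subsingleton_of_forall_finiteIndex_eq_top
      ((h E _ hE π hπ).2.ker_eq_top_of_finiteIndex π hker
        (Group.IsPerfect.eq_top_of_finiteIndex_of_central hfin π hπ hker))
    exact π.ker.eq_bot_of_subsingleton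
  · rintro ⟨hfin, hH⟩ G _ _ p hp
    have := Group.isPerfect_of_forall_finiteIndex_eq_top hfin
    exact ⟨profiniteSurj_fiberProduct hfin p hp, profiniteInj_fiberProduct hfin hH p hp⟩
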